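/- arXiv:2402.08097 — 5 statements merged into one kernel-verified Lean document; each statement's English description precedes it below -/
import Mathlib

section
/- Under the AGM-BiO iteration with step sizes a_k = (k+1)/(4 L_f), for every k ≥ 1 the upper-level suboptimality satisfies f(x_k) − f(x*) ≤ 4 L_f ‖x_0 − x*‖² / (k(k+1)). -/
open RealInnerProductSpace

/-- The first-order characterisation of convexity: the graph lies above its tangent planes. -/
lemma ConvexOn.add_inner_gradient_le {E : Type*} [NormedAddCommGroup E] [InnerProductSpace ℝ E]
    [CompleteSpace E] {f : E → ℝ} (hf : ConvexOn ℝ Set.univ f) {f' y : E}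
    (hf' : HasGradientAt f f' y) (w : E) : f y + ⟪f', w - y⟫ ≤ f w := by
  have hline : ConvexOn ℝ Set.univ (f ∘ AffineMap.lineMap (k := ℝ) y w) := by
    simpa using hf.comp_affineMap (AffineMap.lineMap (k := ℝ) y w)
  have hderiv : HasDerivAt (f ∘ AffineMap.lineMap (k := ℝ) y w) ⟪f', w - y⟫ 0 := by
    have h : HasFDerivAt f (InnerProductSpace.toDual ℝ E f') (AffineMap.lineMap y w (0 : ℝ)) := by
      simpa using hf'.hasFDerivAt
    simpa using h.comp_hasDerivAt (0 : ℝ) AffineMap.hasDerivAt_lineMap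
  have h := hline.le_slope_of_hasDerivAt (Set.mem_univ 0) (Set.mem_univ 1) one_pos hderiv
  simp only [slope_def_field, Function.comp_apply, AffineMap.lineMap_apply_one,
    AffineMap.lineMap_apply_zero, sub_zero, div_one] at h
  linarith

/-- An upper quadratic bound for a convex function with `L`-Lipschitz gradient. -/
lemma ConvexOn.le_add_inner_gradient_add {E : Type*} [NormedAddCommGroup E]
    [InnerProductSpace ℝ E] [CompleteSpace E] {f : E → ℝ} {f' : E → E} {L : ℝ}
    (hf : ConvexOn ℝ Set.univ f) (hf' : ∀ w, HasGradientAt f (f' w) w)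
    (hL : ∀ u v, ‖f' u - f' v‖ ≤ L * ‖u - v‖) (y w : E) :
    f w ≤ f y + ⟪f' y, w - y⟫ + L * ‖w - y‖ ^ 2 := by
  have h₁ := hf.add_inner_gradient_le (hf' w) y
  have h₂ : ⟪f' w - f' y, w - y⟫ ≤ L * ‖w - y‖ ^ 2 := by
    calc ⟪f' w - f' y, w - y⟫ ≤ ‖f' w - f' y‖ * ‖w - y‖ := real_inner_le_norm _ _
      _ ≤ L * ‖w - y‖ * ‖w - y‖ := by gcongr; exact hL w y
      _ = L * ‖w - y‖ ^ 2 := by ring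
  rw [inner_sub_left] at h₂
  rw [← neg_sub w y, inner_neg_right] at h₁
  linarith

/-- The variational inequality satisfied by a nearest point of a convex set. -/
lemma Convex.inner_sub_nonpos_of_forall_norm_le {E : Type*} [NormedAddCommGroup E]
    [InnerProductSpace ℝ E] {K : Set E} (hK : Convex ℝ K) {p v : E} (hv : v ∈ K)
    (hmin : ∀ w ∈ K, ‖v - p‖ ≤ ‖w - p‖) {w : E} (hw : w ∈ K) : ⟪p - v, w - v⟫ ≤ 0 := by
  refine (norm_eq_iInf_iff_real_inner_le_zero hK hv).1 (le_antisymm ?_ ?_) w hw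
  · have : Nonempty K := ⟨⟨v, hv⟩⟩
    refine le_ciInf fun u => ?_
    rw [norm_sub_rev p, norm_sub_rev p]
    exact hmin u u.2
  · exact ciInf_le ⟨0, by rintro _ ⟨u, rfl⟩; exact norm_nonneg _⟩ (⟨v, hv⟩ : K)

/-- One step of the accelerated projected gradient method does not increase the potential
`A * (f x - f p) + ‖z - p‖ ^ 2 / 2`. -/
lemma accelerated_gradient_potential_le {E : Type*} [NormedAddCommGroup E]
    [InnerProductSpace ℝ E] [CompleteSpace E] {f : E → ℝ} {f' : E → E} {L : ℝ}
    (hf : ConvexOn ℝ Set.univ f) (hf' : ∀ w, HasGradientAt f (f' w) w)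
    (hL : ∀ u v, ‖f' u - f' v‖ ≤ L * ‖u - v‖) {A a : ℝ} (hA : 0 ≤ A) (ha : 0 < a)
    (hstep : 2 * L * a ^ 2 ≤ A + a) {x y z x₁ z₁ p : E}
    (hy : y = (A / (A + a)) • x + (a / (A + a)) • z)
    (hx₁ : x₁ = (A / (A + a)) • x + (a / (A + a)) • z₁)
    (hproj : ⟪z - a • f' y - z₁, p - z₁⟫ ≤ 0) :
    (A + a) * (f x₁ - f p) + ‖z₁ - p‖ ^ 2 / 2 ≤ A * (f x - f p) + ‖z - p‖ ^ 2 / 2 := by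
  have hpos : 0 < A + a := by linarith
  have hdiff : x₁ - y = (a / (A + a)) • (z₁ - z) := by
    rw [hx₁, hy]; module
  have hcomb : (A + a) • (x₁ - y) = A • (x - y) + a • (z₁ - y) := by
    have : (A + a) • x₁ = A • x + a • z₁ := by
      rw [hx₁, smul_add, smul_smul, smul_smul, mul_div_cancel₀ _ hpos.ne',
        mul_div_cancel₀ _ hpos.ne']
    rw [smul_sub, this]; module
  have hinner : (A + a) * ⟪f' y, x₁ - y⟫ = A * ⟪f' y, x - y⟫ + a * ⟪f' y, z₁ - y⟫ := by
    simpa only [inner_add_right, real_inner_smul_right] using congrArg (fun v => ⟪f' y, v⟫) hcomb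
  have hquad : (A + a) * (L * ‖x₁ - y‖ ^ 2) ≤ ‖z₁ - z‖ ^ 2 / 2 := by
    have hcoef : (A + a) * (L * (a / (A + a)) ^ 2) ≤ 1 / 2 := by
      have : (A + a) * (L * (a / (A + a)) ^ 2) = L * a ^ 2 / (A + a) := by field_simp
      rw [this, div_le_iff₀ hpos]
      linarith
    rw [hdiff, norm_smul, mul_pow, Real.norm_eq_abs, sq_abs]
    nlinarith [mul_le_mul_of_nonneg_right hcoef (sq_nonneg ‖z₁ - z‖)]
  have hupper := mul_le_mul_of_nonneg_left (hf.le_add_inner_gradient_add hf' hL y x₁) hpos.le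
  have hx := mul_le_mul_of_nonneg_left (hf.add_inner_gradient_le (hf' y) x) hA
  have hp := mul_le_mul_of_nonneg_left (hf.add_inner_gradient_le (hf' y) p) ha.le
  have hsplit : ⟪f' y, p - y⟫ = ⟪f' y, z₁ - y⟫ + ⟪f' y, p - z₁⟫ := by
    rw [← inner_add_right]; congr 1; abel
  have hthree : ‖z - p‖ ^ 2 = ‖z - z₁‖ ^ 2 - 2 * ⟪z - z₁, p - z₁⟫ + ‖p - z₁‖ ^ 2 := by
    rw [← norm_sub_sq_real]; congr 2; abel
  rw [show z - a • f' y - z₁ = (z - z₁) - a • f' y by abel, inner_sub_left,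
    real_inner_smul_left] at hproj
  rw [hsplit] at hp
  rw [norm_sub_rev z₁ z] at hquad
  rw [norm_sub_rev z₁ p]
  linarith

theorem agm_bio_upper_level
    {n : ℕ} {f g : EuclideanSpace ℝ (Fin n) → ℝ}
    {f' g' : EuclideanSpace ℝ (Fin n) → EuclideanSpace ℝ (Fin n)}
    {Z : Set (EuclideanSpace ℝ (Fin n))}
    {L_f L_g : ℝ} (hLf : 0 < L_f) (hLg : 0 < L_g)
    (hZconv : Convex ℝ Z) (hZcpt : IsCompact Z)
    {D : ℝ} (hD : ∀ u ∈ Z, ∀ v ∈ Z, ‖u - v‖ ≤ D)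
    (hfconv : ConvexOn ℝ Set.univ f) (hgconv : ConvexOn ℝ Set.univ g)
    (hf' : ∀ w, HasGradientAt f (f' w) w)
    (hg' : ∀ w, HasGradientAt g (g' w) w)
    (hLipf : ∀ u v, ‖f' u - f' v‖ ≤ L_f * ‖u - v‖)
    (hLipg : ∀ u v, ‖g' u - g' v‖ ≤ L_g * ‖u - v‖)
    {xstar : EuclideanSpace ℝ (Fin n)}
    (hxZ : xstar ∈ Z)
    (hxlow : ∀ w ∈ Z, g xstar ≤ g w)
    (hxopt : ∀ w ∈ Z, (∀ u ∈ Z, g w ≤ g u) → f xstar ≤ f w)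
    {x z y : ℕ → EuclideanSpace ℝ (Fin n)} {A a gs : ℕ → ℝ}
    (hA0 : A 0 = 0) (hxz0 : x 0 = z 0)
    (ha : ∀ k : ℕ, a k = ((k : ℝ) + 1) / (4 * L_f))
    (hArec : ∀ k, A (k + 1) = A k + a k)
    (hy : ∀ k, y k = (A k / (A k + a k)) • x k + (a k / (A k + a k)) • z k)
    (hgs : ∀ k : ℕ, 0 ≤ gs k - g xstar ∧
        gs k - g xstar ≤ 2 * L_g * ‖x 0 - xstar‖ ^ 2 / ((k : ℝ) + 1) ^ 2)
    (hzmem : ∀ k, z (k + 1) ∈ Z ∧ g (y k) + ⟪g' (y k), z (k + 1) - y k⟫ ≤ gs k)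
    (hzproj : ∀ k, ∀ w ∈ Z, g (y k) + ⟪g' (y k), w - y k⟫ ≤ gs k →
        ‖z (k + 1) - (z k - a k • f' (y k))‖ ≤ ‖w - (z k - a k • f' (y k))‖)
    (hxrec : ∀ k, x (k + 1) = (A k / (A k + a k)) • x k + (a k / (A k + a k)) • z (k + 1)) :
    ∀ k : ℕ, 1 ≤ k →
      f (x k) - f xstar ≤ 4 * L_f * ‖x 0 - xstar‖ ^ 2 / ((k : ℝ) * ((k : ℝ) + 1)) := by
  have hA : ∀ k : ℕ, A k = (k : ℝ) * ((k : ℝ) + 1) / (8 * L_f) := by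
    intro k
    induction k with
    | zero => simp [hA0]
    | succ k ih =>
      rw [hArec, ih, ha]
      push_cast
      field_simp
      ring
  have hpot : ∀ k : ℕ, A k * (f (x k) - f xstar) + ‖z k - xstar‖ ^ 2 / 2
      ≤ ‖x 0 - xstar‖ ^ 2 / 2 := by
    intro k
    induction k with
    | zero => simp [hA0, hxz0]
    | succ k ih =>
      refine le_trans ?_ ih
      rw [hArec]
      refine accelerated_gradient_potential_le hfconv hf' hLipf ?_ ?_ ?_ (hy k) (hxrec k) ?_
      · rw [hA]; positivity
      · rw [ha]; positivity
      · have hlhs : 2 * L_f * a k ^ 2 = ((k : ℝ) + 1) * ((k : ℝ) + 1) / (8 * L_f) := by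
          rw [ha]; field_simp; ring
        have hrhs : A k + a k = ((k : ℝ) + 1) * ((k : ℝ) + 2) / (8 * L_f) := by
          rw [hA, ha]; field_simp; ring
        rw [hlhs, hrhs]
        gcongr
        norm_num
      · have hK : Convex ℝ (Z ∩ {w | g (y k) + ⟪g' (y k), w - y k⟫ ≤ gs k}) := by
          have hhalf : {w | g (y k) + ⟪g' (y k), w - y k⟫ ≤ gs k} =
              {w | innerSL ℝ (g' (y k)) w ≤ gs k - g (y k) + ⟪g' (y k), y k⟫} := by
            ext w
            simp only [Set.mem_ofPred_eq, inner_sub_right, innerSL_apply_apply]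
            constructor <;> intro h <;> linarith
          rw [hhalf]
          exact hZconv.inter
            (convex_halfSpace_le (innerSL ℝ (g' (y k))).toLinearMap.isLinear _)
        refine hK.inner_sub_nonpos_of_forall_norm_le (hzmem k)
          (fun w hw => hzproj k w hw.1 hw.2) ⟨hxZ, ?_⟩
        have hgx := hgconv.add_inner_gradient_le (hg' (y k)) xstar
        exact hgx.trans (sub_nonneg.1 (hgs k).1)
  intro k hk
  have hk' : (0 : ℝ) < k := by exact_mod_cast hk
  have hbound : A k * (f (x k) - f xstar) ≤ ‖x 0 - xstar‖ ^ 2 / 2 := by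
    linarith [hpot k, sq_nonneg ‖z k - xstar‖]
  rw [hA, div_mul_eq_mul_div, div_le_iff₀ (by positivity)] at hbound
  rw [le_div_iff₀ (by positivity)]
  linarith
end

section
/- Under the AGM-BiO iteration with step sizes a_k = (k+1)/(4 L_f), if at iteration k ≥ 1 the condition f(x_k) ≥ f(x*) holds, then the infeasibility satisfies g(x_k) − g(x*) ≤ 8 L_g ‖x_0 − x*‖² (ln k + 1) / (k(k+1)). -/
open RealInnerProductSpace

section FirstOrder

variable {E : Type*} [NormedAddCommGroup E] [InnerProductSpace ℝ E]

theorem HasGradientAt.hasDerivAt_comp_add_smul [CompleteSpace E] {h : E → ℝ} {G u d : E} {t : ℝ}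
    (hG : HasGradientAt h G (u + t • d)) :
    HasDerivAt (fun s : ℝ => h (u + s • d)) ⟪G, d⟫ t := by
  have hd : HasDerivAt (fun s : ℝ => u + s • d) d t := by
    simpa using ((hasDerivAt_id t).smul_const d).const_add u
  simpa [Function.comp_def] using hG.hasFDerivAt.comp_hasDerivAt t hd

theorem ConvexOn.add_inner_gradient_le_s2 [CompleteSpace E] {h : E → ℝ} {G u : E}
    (hc : ConvexOn ℝ Set.univ h) (hG : HasGradientAt h G u) (v : E) :
    h u + ⟪G, v - u⟫ ≤ h v := by
  have hline : ConvexOn ℝ Set.univ (fun s : ℝ => h (u + s • (v - u))) := by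
    have := hc.comp_affineMap (AffineMap.lineMap u v : ℝ →ᵃ[ℝ] E)
    simpa [Function.comp_def, AffineMap.lineMap_apply, add_comm] using this
  have hd : HasDerivAt (fun s : ℝ => h (u + s • (v - u))) ⟪G, v - u⟫ 0 :=
    HasGradientAt.hasDerivAt_comp_add_smul (by simpa using hG)
  have := hline.le_slope_of_hasDerivAt (Set.mem_univ 0) (Set.mem_univ 1) one_pos hd
  simp [slope_def_field] at this
  linarith

theorem le_add_inner_gradient_add_sq [CompleteSpace E] {h : E → ℝ} {h' : E → E} {L : ℝ}
    (hG : ∀ w, HasGradientAt h (h' w) w) (hL : ∀ u v, ‖h' u - h' v‖ ≤ L * ‖u - v‖) (u v : E) :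
    h v ≤ h u + ⟪h' u, v - u⟫ + L / 2 * ‖v - u‖ ^ 2 := by
  set d := v - u with hd
  let φ : ℝ → ℝ := fun t => h (u + t • d) - t * ⟪h' u, d⟫ - L / 2 * ‖d‖ ^ 2 * t ^ 2
  have hφ (t : ℝ) :
      HasDerivAt φ (⟪h' (u + t • d), d⟫ - ⟪h' u, d⟫ - L * ‖d‖ ^ 2 * t) t := by
    have h1 := (hG (u + t • d)).hasDerivAt_comp_add_smul
    have h2 := (hasDerivAt_id t).mul_const ⟪h' u, d⟫
    have h3 := ((hasDerivAt_id t).pow 2).const_mul (L / 2 * ‖d‖ ^ 2)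
    exact ((h1.sub h2).sub h3).congr_deriv (by simp; ring)
  have hanti : AntitoneOn φ (Set.Icc 0 1) := by
    refine antitoneOn_of_deriv_nonpos (convex_Icc 0 1)
      (fun t _ => (hφ t).continuousAt.continuousWithinAt)
      (fun t _ => (hφ t).differentiableAt.differentiableWithinAt) fun t ht => ?_
    have ht0 : 0 ≤ t := (interior_subset ht).1
    rw [(hφ t).deriv, ← inner_sub_left]
    have hn : ‖h' (u + t • d) - h' u‖ ≤ L * (t * ‖d‖) := by
      simpa [norm_smul, abs_of_nonneg ht0] using hL (u + t • d) u
    nlinarith [real_inner_le_norm (h' (u + t • d) - h' u) d,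
      mul_le_mul_of_nonneg_right hn (norm_nonneg d)]
  have := hanti (Set.left_mem_Icc.2 zero_le_one) (Set.right_mem_Icc.2 zero_le_one) zero_le_one
  simp [φ, hd] at this
  simp only [hd]
  linarith

theorem Convex.inner_le_zero_of_forall_norm_le {K : Set E} (hK : Convex ℝ K) {p v w : E}
    (hp : p ∈ K) (hmin : ∀ q ∈ K, ‖p - v‖ ≤ ‖q - v‖) (hw : w ∈ K) : ⟪v - p, w - p⟫ ≤ 0 := by
  refine (norm_eq_iInf_iff_real_inner_le_zero hK hp).1 ?_ w hw
  have : Nonempty K := ⟨⟨p, hp⟩⟩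
  refine le_antisymm (le_ciInf fun q => ?_)
    (ciInf_le ⟨0, Set.forall_mem_range.2 fun _ => norm_nonneg _⟩ (⟨p, hp⟩ : K))
  simpa only [norm_sub_rev] using hmin q q.2

theorem accelerated_step_le [CompleteSpace E] {h : E → ℝ} {h' : E → E} {L A a : ℝ}
    {x y z x₁ z₁ : E} (hc : ConvexOn ℝ Set.univ h) (hG : ∀ w, HasGradientAt h (h' w) w)
    (hL : ∀ u v, ‖h' u - h' v‖ ≤ L * ‖u - v‖) (hA : 0 ≤ A) (ha : 0 < a)
    (hy : y = (A / (A + a)) • x + (a / (A + a)) • z)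
    (hx₁ : x₁ = (A / (A + a)) • x + (a / (A + a)) • z₁) :
    (A + a) * h x₁ ≤ A * h x + a * (h y + ⟪h' y, z₁ - y⟫)
      + L * a ^ 2 / (2 * (A + a)) * ‖z₁ - z‖ ^ 2 := by
  have hS : 0 < A + a := by positivity
  have hdiff : x₁ - y = (a / (A + a)) • (z₁ - z) := by rw [hx₁, hy]; module
  have hcomb : (A + a) • (x₁ - y) = A • (x - y) + a • (z₁ - y) := by
    have : (A + a) • x₁ = A • x + a • z₁ := by
      rw [hx₁, smul_add, smul_smul, smul_smul, mul_div_cancel₀ _ hS.ne',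
        mul_div_cancel₀ _ hS.ne']
    rw [smul_sub, this]; module
  have hinner : (A + a) * ⟪h' y, x₁ - y⟫ = A * ⟪h' y, x - y⟫ + a * ⟪h' y, z₁ - y⟫ := by
    simpa only [inner_add_right, inner_smul_right] using congrArg (fun w => ⟪h' y, w⟫) hcomb
  have hnorm : (A + a) * (L / 2 * ‖x₁ - y‖ ^ 2) =
      L * a ^ 2 / (2 * (A + a)) * ‖z₁ - z‖ ^ 2 := by
    rw [hdiff, norm_smul, mul_pow, Real.norm_eq_abs, sq_abs]
    field_simp
  have h1 := mul_le_mul_of_nonneg_left (le_add_inner_gradient_add_sq hG hL y x₁) hS.le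
  have h2 := mul_le_mul_of_nonneg_left (hc.add_inner_gradient_le_s2 (hG y) x) hA
  linarith

theorem Convex.inner_gradient_step_le {K : Set E} (hK : Convex ℝ K) {a : ℝ} {G z p w : E}
    (hp : p ∈ K) (hmin : ∀ q ∈ K, ‖p - (z - a • G)‖ ≤ ‖q - (z - a • G)‖) (hw : w ∈ K) :
    a * ⟪G, p - w⟫ ≤ (‖z - w‖ ^ 2 - ‖p - w‖ ^ 2 - ‖p - z‖ ^ 2) / 2 := by
  have hproj := hK.inner_le_zero_of_forall_norm_le hp hmin hw
  have hsplit : ⟪z - a • G - p, w - p⟫ = a * ⟪G, p - w⟫ + ⟪p - z, p - w⟫ := by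
    simp only [inner_sub_left, inner_sub_right, real_inner_smul_left]
    ring
  have hsq := norm_sub_sq_real (p - w) (p - z)
  rw [show p - w - (p - z) = z - w by abel, real_inner_comm] at hsq
  linarith

end FirstOrder

theorem sum_inv_add_one_le_one_add_log (k : ℕ) :
    ∑ i ∈ Finset.range k, ((i : ℝ) + 1)⁻¹ ≤ 1 + Real.log k := by
  simpa [harmonic] using harmonic_le_one_add_log k



theorem agm_bio_lower_level_improved
    {n : ℕ} {f g : EuclideanSpace ℝ (Fin n) → ℝ}
    {f' g' : EuclideanSpace ℝ (Fin n) → EuclideanSpace ℝ (Fin n)}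
    {Z : Set (EuclideanSpace ℝ (Fin n))}
    {L_f L_g : ℝ} (hLf : 0 < L_f) (hLg : 0 < L_g)
    (hZconv : Convex ℝ Z) (hZcpt : IsCompact Z)
    (hfconv : ConvexOn ℝ Set.univ f) (hgconv : ConvexOn ℝ Set.univ g)
    (hf' : ∀ w, HasGradientAt f (f' w) w)
    (hg' : ∀ w, HasGradientAt g (g' w) w)
    (hLipf : ∀ u v, ‖f' u - f' v‖ ≤ L_f * ‖u - v‖)
    (hLipg : ∀ u v, ‖g' u - g' v‖ ≤ L_g * ‖u - v‖)
    {xstar : EuclideanSpace ℝ (Fin n)}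
    (hxZ : xstar ∈ Z)
    (hxlow : ∀ w ∈ Z, g xstar ≤ g w)
    (hxopt : ∀ w ∈ Z, (∀ u ∈ Z, g w ≤ g u) → f xstar ≤ f w)
    {x z y : ℕ → EuclideanSpace ℝ (Fin n)} {A a gs : ℕ → ℝ}
    (hA0 : A 0 = 0) (hxz0 : x 0 = z 0)
    (ha : ∀ k : ℕ, a k = ((k : ℝ) + 1) / (4 * L_f))
    (hArec : ∀ k, A (k + 1) = A k + a k)
    (hy : ∀ k, y k = (A k / (A k + a k)) • x k + (a k / (A k + a k)) • z k)
    (hgs : ∀ k : ℕ, 0 ≤ gs k - g xstar ∧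
        gs k - g xstar ≤ 2 * L_g * ‖x 0 - xstar‖ ^ 2 / ((k : ℝ) + 1) ^ 2)
    (hzmem : ∀ k, z (k + 1) ∈ Z ∧ g (y k) + ⟪g' (y k), z (k + 1) - y k⟫ ≤ gs k)
    (hzproj : ∀ k, ∀ w ∈ Z, g (y k) + ⟪g' (y k), w - y k⟫ ≤ gs k →
        ‖z (k + 1) - (z k - a k • f' (y k))‖ ≤ ‖w - (z k - a k • f' (y k))‖)
    (hxrec : ∀ k, x (k + 1) = (A k / (A k + a k)) • x k + (a k / (A k + a k)) • z (k + 1)) :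
    ∀ k : ℕ, 1 ≤ k → f xstar ≤ f (x k) →
      g (x k) - g xstar ≤
        8 * L_g * ‖x 0 - xstar‖ ^ 2 * (Real.log (k : ℝ) + 1) / ((k : ℝ) * ((k : ℝ) + 1)) := by
  intro k hk hfk
  set D := ‖x 0 - xstar‖ with hD
  have hA (i : ℕ) : A i = (i : ℝ) * (i + 1) / (8 * L_f) := by
    induction i with
    | zero => simp [hA0]
    | succ i ih => rw [hArec, ih, ha]; push_cast; field_simp; ring
  have hA_nonneg (i : ℕ) : 0 ≤ A i := by rw [hA]; positivity
  have ha_pos (i : ℕ) : 0 < a i := by rw [ha]; positivity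
  have hcoef {L : ℝ} (hL : 0 < L) (i : ℕ) :
      L * a i ^ 2 / (2 * (A i + a i)) ≤ L / (4 * L_f) := by
    rw [div_le_div_iff₀ (by linarith [hA_nonneg i, ha_pos i]) (by positivity), ← hArec, hA, ha]
    have : L * ((i + 1) / (4 * L_f)) ^ 2 * (4 * L_f) = L / (4 * L_f) * ((i : ℝ) + 1) ^ 2 := by
      field_simp
    have h' : L * (2 * (((i + 1 : ℕ) : ℝ) * ((i + 1 : ℕ) + 1) / (8 * L_f))) =
        L / (4 * L_f) * (((i : ℝ) + 1) * (i + 2)) := by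
      push_cast; field_simp; ring
    rw [this, h']
    gcongr
    nlinarith [(Nat.cast_nonneg i : (0 : ℝ) ≤ i)]
  have hstar (i : ℕ) : g (y i) + ⟪g' (y i), xstar - y i⟫ ≤ gs i := by
    linarith [hgconv.add_inner_gradient_le_s2 (hg' (y i)) xstar, (hgs i).1]
  have hXconv (i : ℕ) : Convex ℝ {w ∈ Z | g (y i) + ⟪g' (y i), w - y i⟫ ≤ gs i} := by
    refine fun u hu v hv s t hs ht hst => ⟨hZconv hu.1 hv.1 hs ht hst, ?_⟩
    have hs' := mul_le_mul_of_nonneg_left hu.2 hs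
    have ht' := mul_le_mul_of_nonneg_left hv.2 ht
    obtain rfl : t = 1 - s := by linarith
    have hcomb : s • u + (1 - s) • v - y i = s • (u - y i) + (1 - s) • (v - y i) := by module
    rw [hcomb, inner_add_right, real_inner_smul_right, real_inner_smul_right]
    linarith
  have hupper (m : ℕ) : A m * (f (x m) - f xstar) + ‖z m - xstar‖ ^ 2 / 2
      + (∑ i ∈ Finset.range m, ‖z (i + 1) - z i‖ ^ 2) / 4 ≤ D ^ 2 / 2 := by
    induction m with
    | zero => simp [hA0, hD, hxz0]
    | succ m ih =>
      have hstep := accelerated_step_le hfconv hf' hLipf (hA_nonneg m) (ha_pos m) (hy m) (hxrec m)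
      have hproj := (hXconv m).inner_gradient_step_le (hzmem m)
        (fun q hq => hzproj m q hq.1 hq.2) ⟨hxZ, hstar m⟩
      have hlin := mul_le_mul_of_nonneg_left
        (hfconv.add_inner_gradient_le_s2 (hf' (y m)) xstar) (ha_pos m).le
      have hc := mul_le_mul_of_nonneg_right (hcoef hLf m) (sq_nonneg ‖z (m + 1) - z m‖)
      rw [show L_f / (4 * L_f) = 1 / 4 by field_simp] at hc
      rw [Finset.sum_range_succ, hArec]
      simp only [inner_sub_right] at hstep hproj hlin
      linarith
  have hlower (m : ℕ) : A m * (g (x m) - g xstar) ≤ L_g / (4 * L_f) *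
      (2 * D ^ 2 * ∑ i ∈ Finset.range m, ((i : ℝ) + 1)⁻¹
        + ∑ i ∈ Finset.range m, ‖z (i + 1) - z i‖ ^ 2) := by
    induction m with
    | zero => simp [hA0]
    | succ m ih =>
      have hstep := accelerated_step_le hgconv hg' hLipg (hA_nonneg m) (ha_pos m) (hy m) (hxrec m)
      have hmem := mul_le_mul_of_nonneg_left (hzmem m).2 (ha_pos m).le
      have hgap := mul_le_mul_of_nonneg_left (hgs m).2 (ha_pos m).le
      have hrate : a m * (2 * L_g * D ^ 2 / ((m : ℝ) + 1) ^ 2) =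
          L_g / (4 * L_f) * (2 * D ^ 2 * ((m : ℝ) + 1)⁻¹) := by
        rw [ha]; field_simp
      have hc := mul_le_mul_of_nonneg_right (hcoef hLg m) (sq_nonneg ‖z (m + 1) - z m‖)
      rw [Finset.sum_range_succ, Finset.sum_range_succ, hArec]
      linarith
  have hk0 : (0 : ℝ) < k := by exact_mod_cast hk
  have hlog : 0 ≤ Real.log k := Real.log_natCast_nonneg k
  have hpath : ∑ i ∈ Finset.range k, ‖z (i + 1) - z i‖ ^ 2 ≤ 2 * D ^ 2 := by
    linarith [hupper k, mul_nonneg (hA_nonneg k) (sub_nonneg.2 hfk), sq_nonneg ‖z k - xstar‖]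
  have hbound : A k * (g (x k) - g xstar) ≤
      L_g / (4 * L_f) * (4 * D ^ 2 * (Real.log k + 1)) := by
    refine (hlower k).trans ?_
    gcongr
    nlinarith [mul_le_mul_of_nonneg_left (sum_inv_add_one_le_one_add_log k) (sq_nonneg D),
      mul_nonneg (sq_nonneg D) hlog]
  rw [le_div_iff₀ (by positivity)]
  have hbound' := mul_le_mul_of_nonneg_left hbound (by positivity : 0 ≤ 8 * L_f)
  rw [hA] at hbound'
  field_simp at hbound'
  linarith
end

section
/- Suppose g satisfies the r-th order Hölderian error bound with r > 1. Run the AGM-BiO iteration for T iterations with step sizes a_k = γ(k+1)/(4 L_f) where γ = 1/( (2 L_g / L_f) T^{(2r−2)/(2r−1)} + 2 ). Then the output x_T satisfies the lower bound f(x_T) − f(x*) ≥ −C · max{ (2 C_g (ln T + 1))^{1/r} / T^{2/(2r−1)} + (2 C_f)^{1/r} / T^{2/r} , (2C)^{1/(r−1)} / T^{2/(2r−1)} }, where C_f = 8 L_f ‖x_0 − x*‖², C_g = 12 L_g ‖x_0 − x*‖², C = M (r/α)^{1/r}, and M = max_{x ∈ X_g*} ‖∇f(x)‖. -/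
open RealInnerProductSpace

section GradientInequalities

variable {F : Type*} [NormedAddCommGroup F] [InnerProductSpace ℝ F] [CompleteSpace F]
  {h : F → ℝ}

theorem HasGradientAt.hasDerivAt_comp_line {v x d : F} {t : ℝ}
    (hv : HasGradientAt h v (x + t • d)) :
    HasDerivAt (fun s : ℝ => h (x + s • d)) ⟪v, d⟫ t := by
  have hline : HasDerivAt (fun s : ℝ => x + s • d) d t := by
    simpa using ((hasDerivAt_id t).smul_const d).const_add x
  have := hv.hasFDerivAt.comp_hasDerivAt t hline
  rwa [InnerProductSpace.toDual_apply_apply] at this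

theorem ConvexOn.add_inner_le_of_hasGradientAt (hconv : ConvexOn ℝ Set.univ h) {v x : F}
    (hv : HasGradientAt h v x) (y : F) : h x + ⟪v, y - x⟫ ≤ h y := by
  have hline : ConvexOn ℝ Set.univ (fun s : ℝ => h (x + s • (y - x))) := by
    have := hconv.comp_affineMap (AffineMap.lineMap x y)
    simpa [Function.comp_def, AffineMap.lineMap_apply, add_comm] using this
  have hder : HasDerivAt (fun s : ℝ => h (x + s • (y - x))) ⟪v, y - x⟫ 0 :=
    HasGradientAt.hasDerivAt_comp_line (by simpa using hv)
  have := hline.le_slope_of_hasDerivAt (Set.mem_univ 0) (Set.mem_univ 1) one_pos hder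
  simp [slope_def_field] at this
  linarith

theorem le_add_inner_add_sq_of_lipschitz_gradient {h' : F → F} {L : ℝ}
    (hh' : ∀ w, HasGradientAt h (h' w) w) (hLip : ∀ u v, ‖h' u - h' v‖ ≤ L * ‖u - v‖)
    (x y : F) : h y ≤ h x + ⟪h' x, y - x⟫ + L / 2 * ‖y - x‖ ^ 2 := by
  set d := y - x with hd
  have hder (t : ℝ) : HasDerivAt
      (fun s : ℝ => h (x + s • d) - s * ⟪h' x, d⟫ - L / 2 * ‖d‖ ^ 2 * s ^ 2)
      (⟪h' (x + t • d), d⟫ - ⟪h' x, d⟫ - L * ‖d‖ ^ 2 * t) t := by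
    have h1 := (hh' (x + t • d)).hasDerivAt_comp_line
    have h2 := (hasDerivAt_id t).mul_const ⟪h' x, d⟫
    have h3 := ((hasDerivAt_id t).pow 2).const_mul (L / 2 * ‖d‖ ^ 2)
    refine ((h1.sub h2).sub h3).congr_deriv ?_
    simp only [id, Nat.cast_ofNat]
    ring
  have hanti : AntitoneOn
      (fun s : ℝ => h (x + s • d) - s * ⟪h' x, d⟫ - L / 2 * ‖d‖ ^ 2 * s ^ 2)
      (Set.Icc 0 1) := by
    refine antitoneOn_of_deriv_nonpos (convex_Icc 0 1)
      (fun t _ => (hder t).continuousAt.continuousWithinAt)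
      (fun t _ => (hder t).differentiableAt.differentiableWithinAt) fun t ht => ?_
    rw [interior_Icc] at ht
    rw [(hder t).deriv, ← inner_sub_left]
    have h1 := real_inner_le_norm (h' (x + t • d) - h' x) d
    have h2 := hLip (x + t • d) x
    rw [add_sub_cancel_left, norm_smul, Real.norm_of_nonneg ht.1.le] at h2
    nlinarith [mul_le_mul_of_nonneg_right h2 (norm_nonneg d)]
  have := hanti (Set.left_mem_Icc.2 zero_le_one) (Set.right_mem_Icc.2 zero_le_one) zero_le_one
  simp [hd] at this
  linarith

/-- One step of linear coupling: the convex combination `x'` of `x` and `z'` satisfies a descent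
estimate relative to the linearization at the same combination `y` of `x` and `z`. -/
theorem ConvexOn.linear_coupling_step (hconv : ConvexOn ℝ Set.univ h) {h' : F → F} {L : ℝ}
    (hh' : ∀ w, HasGradientAt h (h' w) w) (hLip : ∀ u v, ‖h' u - h' v‖ ≤ L * ‖u - v‖)
    {A a : ℝ} (hA : 0 ≤ A) (ha : 0 < a) {x y z x' z' : F}
    (hy : y = (A / (A + a)) • x + (a / (A + a)) • z)
    (hx' : x' = (A / (A + a)) • x + (a / (A + a)) • z') :
    (A + a) * h x' ≤ A * h x + a * (h y + ⟪h' y, z' - y⟫) +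
      L * a ^ 2 / (2 * (A + a)) * ‖z' - z‖ ^ 2 := by
  have hAa : 0 < A + a := by positivity
  have hdiff : x' - y = (a / (A + a)) • (z' - z) := by
    rw [hy, hx', smul_sub]; abel
  have hcomb : (A + a) • (x' - y) = A • (x - y) + a • (z' - y) := by
    have : (A + a) • x' = A • x + a • z' := by
      rw [hx', smul_add, smul_smul, smul_smul, mul_div_cancel₀ _ hAa.ne',
        mul_div_cancel₀ _ hAa.ne']
    rw [smul_sub, this, add_smul, smul_sub, smul_sub]; abel
  have hinner : (A + a) * ⟪h' y, x' - y⟫ = A * ⟪h' y, x - y⟫ + a * ⟪h' y, z' - y⟫ := by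
    simpa [inner_add_right, real_inner_smul_right] using congrArg (fun w => ⟪h' y, w⟫) hcomb
  have hdesc := mul_le_mul_of_nonneg_left
    (le_add_inner_add_sq_of_lipschitz_gradient hh' hLip y x') hAa.le
  have hnorm : (A + a) * (L / 2 * ‖x' - y‖ ^ 2) =
      L * a ^ 2 / (2 * (A + a)) * ‖z' - z‖ ^ 2 := by
    rw [hdiff, norm_smul, Real.norm_of_nonneg (by positivity)]
    field_simp
  have hlin := mul_le_mul_of_nonneg_left (hconv.add_inner_le_of_hasGradientAt (hh' y) x) hA
  linarith

end GradientInequalities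

theorem real_inner_nonpos_of_norm_sub_minimal {F : Type*} [NormedAddCommGroup F]
    [InnerProductSpace ℝ F] {K : Set F} (hK : Convex ℝ K) {u v : F} (hv : v ∈ K)
    (hmin : ∀ w ∈ K, ‖v - u‖ ≤ ‖w - u‖) {w : F} (hw : w ∈ K) : ⟪u - v, w - v⟫ ≤ 0 := by
  have : Nonempty K := ⟨⟨v, hv⟩⟩
  refine (norm_eq_iInf_iff_real_inner_le_zero hK hv).1 (le_antisymm ?_ ?_) w hw
  · refine le_ciInf fun w => ?_
    rw [norm_sub_rev u, norm_sub_rev u]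
    exact hmin w w.2
  · exact ciInf_le ⟨0, by rintro _ ⟨w, rfl⟩; positivity⟩ (⟨v, hv⟩ : K)

/-- Solving `T ^ p * G ≤ a / T ^ q + b / T ^ 2 + C * G ^ (1 / r)` for `G ^ (1 / r)`. -/
theorem rpow_le_max_of_mul_le_add_rpow {r T a b C G : ℝ} (hr : 1 < r) (hT : 1 ≤ T)
    (ha : 0 ≤ a) (hb : 0 ≤ b) (hC : 0 ≤ C) (hG : 0 ≤ G)
    (h : T ^ ((2 * r - 2) / (2 * r - 1)) * G ≤
      T ^ ((2 * r - 2) / (2 * r - 1)) * a / T ^ 2 + b / T ^ 2 + C * G ^ (1 / r)) :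
    G ^ (1 / r) ≤
      max ((2 * a) ^ (1 / r) / T ^ (2 / (2 * r - 1)) + (2 * b) ^ (1 / r) / T ^ (2 / r))
        ((2 * C) ^ (1 / (r - 1)) / T ^ (2 / (2 * r - 1))) := by
  have hT0 : 0 < T := by linarith
  have hr0 : 0 < r := by linarith
  have hr1 : 0 < r - 1 := by linarith
  have h2r : 0 < 2 * r - 1 := by linarith
  set p := (2 * r - 2) / (2 * r - 1) with hp
  have hp0 : 0 ≤ p := div_nonneg (by linarith) h2r.le
  have hTp : 1 ≤ T ^ p := Real.one_le_rpow hT hp0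
  rcases le_total (T ^ p * a / T ^ 2 + b / T ^ 2) (C * G ^ (1 / r)) with hcase | hcase
  · refine le_max_of_le_right ?_
    rcases hG.eq_or_lt with rfl | hGpos
    · rw [Real.zero_rpow (by positivity)]; positivity
    have hGr : 0 < G ^ (1 / r) := Real.rpow_pos_of_pos hGpos _
    have hsplit : G = (G ^ (1 / r)) ^ (r - 1) * G ^ (1 / r) := by
      rw [← Real.rpow_mul hG, ← Real.rpow_add hGpos]
      rw [show 1 / r * (r - 1) + 1 / r = 1 by field_simp; ring, Real.rpow_one]
    have hle : (G ^ (1 / r)) ^ (r - 1) ≤ 2 * C / T ^ p := by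
      rw [le_div_iff₀ (by positivity)]
      refine le_of_mul_le_mul_right ?_ hGr
      calc (G ^ (1 / r)) ^ (r - 1) * T ^ p * G ^ (1 / r)
          = T ^ p * ((G ^ (1 / r)) ^ (r - 1) * G ^ (1 / r)) := by ring
        _ = T ^ p * G := by rw [← hsplit]
        _ ≤ 2 * C * G ^ (1 / r) := by linarith
    calc G ^ (1 / r) = ((G ^ (1 / r)) ^ (r - 1)) ^ (1 / (r - 1)) := by
          rw [← Real.rpow_mul hGr.le, mul_one_div_cancel hr1.ne', Real.rpow_one]
      _ ≤ (2 * C / T ^ p) ^ (1 / (r - 1)) := by gcongr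
      _ = (2 * C) ^ (1 / (r - 1)) / T ^ (2 / (2 * r - 1)) := by
          rw [Real.div_rpow (by positivity) (by positivity), ← Real.rpow_mul hT0.le]
          congr 2
          rw [hp]; field_simp
  · refine le_max_of_le_left ?_
    have hle : G ≤ 2 * a / T ^ 2 + 2 * b / T ^ 2 := by
      refine le_of_mul_le_mul_left ?_ (by positivity : 0 < T ^ p)
      have : b / T ^ 2 ≤ T ^ p * (b / T ^ 2) := le_mul_of_one_le_left (by positivity) hTp
      calc T ^ p * G ≤ 2 * (T ^ p * a / T ^ 2 + T ^ p * (b / T ^ 2)) := by linarith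
        _ = _ := by ring
    have hrinv : 1 / r ≤ 1 := (div_le_one hr0).2 hr.le
    have hroot (c : ℝ) (hc : 0 ≤ c) : (c / T ^ 2) ^ (1 / r) = c ^ (1 / r) / T ^ (2 / r) := by
      rw [Real.div_rpow hc (by positivity), ← Real.rpow_natCast, ← Real.rpow_mul hT0.le]
      congr 2
      push_cast
      ring
    calc G ^ (1 / r) ≤ (2 * a / T ^ 2 + 2 * b / T ^ 2) ^ (1 / r) := by gcongr
      _ ≤ (2 * a / T ^ 2) ^ (1 / r) + (2 * b / T ^ 2) ^ (1 / r) :=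
          Real.rpow_add_le_add_rpow (by positivity) (by positivity) (by positivity) hrinv
      _ = (2 * a) ^ (1 / r) / T ^ (2 / r) + (2 * b) ^ (1 / r) / T ^ (2 / r) := by
          rw [hroot _ (by positivity), hroot _ (by positivity)]
      _ ≤ _ := by
          gcongr
          linarith


theorem agm_bio_heb_lower_bound
    {n : ℕ} {f g : EuclideanSpace ℝ (Fin n) → ℝ}
    {f' g' : EuclideanSpace ℝ (Fin n) → EuclideanSpace ℝ (Fin n)}
    {Z : Set (EuclideanSpace ℝ (Fin n))}
    {L_f L_g : ℝ} (hLf : 0 < L_f) (hLg : 0 < L_g)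
    (hZconv : Convex ℝ Z) (hZcl : IsClosed Z)
    (hfconv : ConvexOn ℝ Set.univ f) (hgconv : ConvexOn ℝ Set.univ g)
    (hf' : ∀ w, HasGradientAt f (f' w) w)
    (hg' : ∀ w, HasGradientAt g (g' w) w)
    (hLipf : ∀ u v, ‖f' u - f' v‖ ≤ L_f * ‖u - v‖)
    (hLipg : ∀ u v, ‖g' u - g' v‖ ≤ L_g * ‖u - v‖)
    {xstar : EuclideanSpace ℝ (Fin n)}
    (hxZ : xstar ∈ Z)
    (hxlow : ∀ w ∈ Z, g xstar ≤ g w)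
    (hxopt : ∀ w ∈ Z, (∀ u ∈ Z, g w ≤ g u) → f xstar ≤ f w)
    {α r : ℝ} (hα : 0 < α) (hr : 1 < r)
    (hHEB : ∀ w ∈ Z, α / r * Metric.infDist w {w ∈ Z | ∀ u ∈ Z, g w ≤ g u} ^ r ≤ g w - g xstar)
    {M : ℝ} (hM : IsGreatest ((fun w => ‖f' w‖) '' {w ∈ Z | ∀ u ∈ Z, g w ≤ g u}) M)
    {T : ℕ} (hT : 1 ≤ T) {γ : ℝ}
    (hγ : γ = 1 / (2 * L_g / L_f * (T : ℝ) ^ ((2 * r - 2) / (2 * r - 1)) + 2))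
    {x z y : ℕ → EuclideanSpace ℝ (Fin n)} {A a gs : ℕ → ℝ}
    (hA0 : A 0 = 0) (hxz0 : x 0 = z 0)
    (ha : ∀ k : ℕ, a k = γ * ((k : ℝ) + 1) / (4 * L_f))
    (hArec : ∀ k, A (k + 1) = A k + a k)
    (hy : ∀ k, y k = (A k / (A k + a k)) • x k + (a k / (A k + a k)) • z k)
    (hgs : ∀ k : ℕ, 0 ≤ gs k - g xstar ∧
        gs k - g xstar ≤ 2 * L_g * ‖x 0 - xstar‖ ^ 2 / ((k : ℝ) + 1) ^ 2)
    (hzmem : ∀ k, z (k + 1) ∈ Z ∧ g (y k) + ⟪g' (y k), z (k + 1) - y k⟫ ≤ gs k)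
    (hzproj : ∀ k, ∀ w ∈ Z, g (y k) + ⟪g' (y k), w - y k⟫ ≤ gs k →
        ‖z (k + 1) - (z k - a k • f' (y k))‖ ≤ ‖w - (z k - a k • f' (y k))‖)
    (hxrec : ∀ k, x (k + 1) = (A k / (A k + a k)) • x k + (a k / (A k + a k)) • z (k + 1)) :
    f (x T) - f xstar ≥
      -(M * (r / α) ^ (1 / r)) *
        max ((2 * (12 * L_g * ‖x 0 - xstar‖ ^ 2) * (Real.log (T : ℝ) + 1)) ^ (1 / r) /
              (T : ℝ) ^ (2 / (2 * r - 1)) +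
            (2 * (8 * L_f * ‖x 0 - xstar‖ ^ 2)) ^ (1 / r) / (T : ℝ) ^ (2 / r))
          ((2 * (M * (r / α) ^ (1 / r))) ^ (1 / (r - 1)) / (T : ℝ) ^ (2 / (2 * r - 1))) := by
  set D := ‖x 0 - xstar‖ with hD
  set S := {w ∈ Z | ∀ u ∈ Z, g w ≤ g u}
  set lam : ℝ := (T : ℝ) ^ ((2 * r - 2) / (2 * r - 1))
  have hT0 : (0 : ℝ) < T := by exact_mod_cast hT
  have hT1 : (1 : ℝ) ≤ T := by exact_mod_cast hT
  have hlam0 : 0 < lam := Real.rpow_pos_of_pos hT0 _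
  have hγ' : γ = L_f / (2 * lam * L_g + 2 * L_f) := by rw [hγ]; field_simp
  have hγ0 : 0 < γ := by rw [hγ']; positivity
  have ha0 (k : ℕ) : 0 < a k := by rw [ha]; positivity
  have hA (k : ℕ) : A k = γ * k * (k + 1) / (8 * L_f) := by
    induction k with
    | zero => simp [hA0]
    | succ k ih => rw [hArec, ih, ha]; push_cast; field_simp; ring
  have hAnn (k : ℕ) : 0 ≤ A k := by rw [hA]; positivity
  have hstepsize (k : ℕ) : (L_f + lam * L_g) * (a k ^ 2 / (A k + a k)) ≤ 1 := by
    have h1 : a k ^ 2 / (A k + a k) = γ / (2 * L_f) * ((k + 1) / (k + 2)) := by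
      rw [hA, ha]; field_simp; ring
    have h2 : ((k : ℝ) + 1) / (k + 2) ≤ 1 := (div_le_one (by positivity)).2 (by linarith)
    have h3 : (L_f + lam * L_g) * (γ / (2 * L_f)) ≤ 1 := by
      rw [hγ']
      field_simp
      nlinarith [mul_pos hlam0 hLg]
    rw [h1, ← mul_assoc]
    exact mul_le_one₀ h3 (by positivity) h2
  have hxmem (k : ℕ) : x (k + 1) ∈ Z := by
    induction k with
    | zero =>
      rw [hxrec, hA0, zero_add, zero_div, zero_smul, zero_add, div_self (ha0 0).ne', one_smul]
      exact (hzmem 0).1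
    | succ k ih =>
      rw [hxrec]
      have hpos : 0 < A (k + 1) + a (k + 1) := add_pos_of_nonneg_of_pos (hAnn _) (ha0 _)
      refine hZconv ih (hzmem _).1 (div_nonneg (hAnn _) hpos.le) (div_nonneg (ha0 _).le hpos.le) ?_
      rw [← add_div, div_self hpos.ne']
  have hproj (k : ℕ) : ⟪z k - a k • f' (y k) - z (k + 1), xstar - z (k + 1)⟫ ≤ 0 := by
    have hhalf : Convex ℝ {w | g (y k) + ⟪g' (y k), w - y k⟫ ≤ gs k} := by
      have : {w | g (y k) + ⟪g' (y k), w - y k⟫ ≤ gs k} =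
          {w | innerSL ℝ (g' (y k)) w ≤ gs k - g (y k) + ⟪g' (y k), y k⟫} := by
        ext w
        simp only [Set.mem_ofPred_eq, innerSL_apply_apply, inner_sub_right]
        constructor <;> intro <;> linarith
      rw [this]
      exact convex_halfSpace_le (innerSL ℝ (g' (y k))).toLinearMap.isLinear _
    refine real_inner_nonpos_of_norm_sub_minimal (hZconv.inter hhalf) (hzmem k)
      (fun w hw => hzproj k w hw.1 hw.2) ⟨hxZ, ?_⟩
    have := hgconv.add_inner_le_of_hasGradientAt (hg' (y k)) xstar
    have := (hgs k).1
    simp only [Set.mem_ofPred_eq]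
    linarith
  have hpot (k : ℕ) : A k * (f (x k) - f xstar) + lam * (A k * (g (x k) - g xstar)) +
      ‖z k - xstar‖ ^ 2 / 2 ≤
      D ^ 2 / 2 + lam * (γ * L_g * D ^ 2 / (2 * L_f)) * (harmonic k : ℝ) := by
    induction k with
    | zero => simp [hA0, hD, hxz0]
    | succ k ih =>
      have hf1 := hfconv.linear_coupling_step hf' hLipf (hAnn k) (ha0 k) (hy k) (hxrec k)
      have hg1 := hgconv.linear_coupling_step hg' hLipg (hAnn k) (ha0 k) (hy k) (hxrec k)
      have hf2 := mul_le_mul_of_nonneg_left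
        (hfconv.add_inner_le_of_hasGradientAt (hf' (y k)) xstar) (ha0 k).le
      have hg2 := mul_le_mul_of_nonneg_left (hzmem k).2 (ha0 k).le
      have hthree : a k * ⟪f' (y k), z (k + 1) - y k⟫ ≤ a k * ⟪f' (y k), xstar - y k⟫ +
          ‖z k - xstar‖ ^ 2 / 2 - ‖z (k + 1) - xstar‖ ^ 2 / 2 - ‖z (k + 1) - z k‖ ^ 2 / 2 := by
        have h1 := hproj k
        have h2 : z k - a k • f' (y k) - z (k + 1) =
            -(z (k + 1) - z k) - a k • f' (y k) := by abel
        have h3 : z k - xstar = (z (k + 1) - xstar) - (z (k + 1) - z k) := by abel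
        have h4 : xstar - z (k + 1) = -(z (k + 1) - xstar) := by abel
        have h5 : xstar - y k = (z (k + 1) - y k) - (z (k + 1) - xstar) := by abel
        rw [h2, h4, inner_neg_right, inner_sub_left, inner_neg_left,
          real_inner_smul_left] at h1
        rw [h3, h5, norm_sub_sq_real, inner_sub_right _ (z (k + 1) - y k),
          real_inner_comm (z (k + 1) - z k)]
        linarith
      have hgap : a k * (gs k - g xstar) ≤
          γ * L_g * D ^ 2 / (2 * L_f) * ((k : ℝ) + 1)⁻¹ := by
        calc a k * (gs k - g xstar) ≤ a k * (2 * L_g * D ^ 2 / ((k : ℝ) + 1) ^ 2) :=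
              mul_le_mul_of_nonneg_left (hgs k).2 (ha0 k).le
          _ = _ := by rw [ha]; field_simp; ring
      have hg3 := mul_le_mul_of_nonneg_left (hg1.trans (add_le_add_left
        (add_le_add_right hg2 _) _)) hlam0.le
      have hgap' := mul_le_mul_of_nonneg_left hgap hlam0.le
      have hquad := mul_le_mul_of_nonneg_right (hstepsize k) (sq_nonneg ‖z (k + 1) - z k‖)
      have hquad' : L_f * a k ^ 2 / (2 * (A k + a k)) * ‖z (k + 1) - z k‖ ^ 2 +
          lam * (L_g * a k ^ 2 / (2 * (A k + a k)) * ‖z (k + 1) - z k‖ ^ 2) ≤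
          ‖z (k + 1) - z k‖ ^ 2 / 2 := by
        have hpos : 0 < A k + a k := add_pos_of_nonneg_of_pos (hAnn _) (ha0 _)
        calc _ = (L_f + lam * L_g) * (a k ^ 2 / (A k + a k)) * ‖z (k + 1) - z k‖ ^ 2 / 2 := by
              field_simp
          _ ≤ _ := by linarith
      rw [harmonic_succ, hArec]
      push_cast
      linarith
  set G := g (x T) - g xstar
  obtain ⟨N, rfl⟩ : ∃ N, T = N + 1 := ⟨T - 1, by omega⟩
  have hxT : x (N + 1) ∈ Z := hxmem N
  have hG0 : 0 ≤ G := sub_nonneg.2 (hxlow _ hxT)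
  set ℓ := Real.log ((N + 1 : ℕ) : ℝ) + 1 with hℓ
  have hℓ0 : 0 ≤ ℓ := by have := Real.log_nonneg hT1; linarith
  have hupper : f (x (N + 1)) - f xstar + lam * G ≤
      lam * (12 * L_g * D ^ 2 * ℓ) / ((N + 1 : ℕ) : ℝ) ^ 2 +
        8 * L_f * D ^ 2 / ((N + 1 : ℕ) : ℝ) ^ 2 := by
    have h1 := hpot (N + 1)
    have h2 : (harmonic (N + 1) : ℝ) ≤ ℓ := by
      have := harmonic_le_one_add_log (N + 1)
      linarith
    rw [hA] at h1
    generalize ((N + 1 : ℕ) : ℝ) = t at *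
    have hcoef : 0 ≤ lam * (γ * L_g * D ^ 2 / (2 * L_f)) := by positivity
    have hpos : 0 < γ * t * (t + 1) / (8 * L_f) := by positivity
    have h3 : γ * t * (t + 1) / (8 * L_f) * (f (x (N + 1)) - f xstar + lam * G) ≤
        D ^ 2 / 2 + lam * (γ * L_g * D ^ 2 / (2 * L_f)) * ℓ := by
      have := mul_le_mul_of_nonneg_left h2 hcoef
      have := sq_nonneg ‖z (N + 1) - xstar‖
      linarith
    have hℓ1 : 1 ≤ ℓ := by have := Real.log_nonneg hT1; linarith
    refine le_of_mul_le_mul_left (h3.trans ?_) hpos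
    have hD2 : D ^ 2 / 2 = γ * (lam * L_g * D ^ 2 / L_f + D ^ 2) := by
      rw [hγ']; field_simp
    have h4 : lam * L_g * D ^ 2 / L_f * 1 ≤ lam * L_g * D ^ 2 / L_f * ℓ := by gcongr
    have h5 : 1 ≤ (t + 1) / t := (one_le_div hT0).2 (by linarith)
    have hE : 0 ≤ γ * (lam * L_g * D ^ 2 / L_f * ℓ * (3 / 2) + D ^ 2) := by positivity
    calc D ^ 2 / 2 + lam * (γ * L_g * D ^ 2 / (2 * L_f)) * ℓ
        = γ * (lam * L_g * D ^ 2 / L_f * 1 + D ^ 2) +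
          lam * (γ * L_g * D ^ 2 / (2 * L_f)) * ℓ := by rw [hD2, mul_one]
      _ ≤ γ * (lam * L_g * D ^ 2 / L_f * ℓ + D ^ 2) +
          lam * (γ * L_g * D ^ 2 / (2 * L_f)) * ℓ := by gcongr
      _ = γ * (lam * L_g * D ^ 2 / L_f * ℓ * (3 / 2) + D ^ 2) * 1 := by ring
      _ ≤ γ * (lam * L_g * D ^ 2 / L_f * ℓ * (3 / 2) + D ^ 2) * ((t + 1) / t) := by gcongr
      _ = _ := by field_simp; ring
  have hM0 : 0 ≤ M := by obtain ⟨w, -, rfl⟩ := hM.1; positivity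
  have hlower : -(M * (r / α) ^ (1 / r)) * G ^ (1 / r) ≤ f (x (N + 1)) - f xstar := by
    have hgcont : Continuous g :=
      continuous_iff_continuousAt.2 fun w => (hg' w).continuousAt
    have hSclosed : IsClosed S := by
      have : S = Z ∩ g ⁻¹' Set.Iic (g xstar) := by
        ext w
        exact ⟨fun hw => ⟨hw.1, hw.2 _ hxZ⟩,
          fun hw => ⟨hw.1, fun u hu => le_trans hw.2 (hxlow u hu)⟩⟩
      rw [this]
      exact hZcl.inter (isClosed_Iic.preimage hgcont)
    obtain ⟨w, hw, hdist⟩ :=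
      hSclosed.exists_infDist_eq_dist ⟨xstar, hxZ, hxlow⟩ (x (N + 1))
    have hgrad := hfconv.add_inner_le_of_hasGradientAt (hf' w) (x (N + 1))
    have hinner := neg_le_of_abs_le (abs_real_inner_le_norm (f' w) (x (N + 1) - w))
    have hbound : ‖f' w‖ * ‖x (N + 1) - w‖ ≤ M * ‖x (N + 1) - w‖ :=
      mul_le_mul_of_nonneg_right (hM.2 ⟨w, hw, rfl⟩) (norm_nonneg _)
    have hr0 : 0 < r := by linarith
    have hHEB' := hHEB _ hxT
    rw [hdist, dist_eq_norm] at hHEB'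
    have hdistG : ‖x (N + 1) - w‖ ≤ (r / α) ^ (1 / r) * G ^ (1 / r) := by
      calc ‖x (N + 1) - w‖ = (‖x (N + 1) - w‖ ^ r) ^ (1 / r) := by
            rw [← Real.rpow_mul (norm_nonneg _), mul_one_div_cancel hr0.ne', Real.rpow_one]
        _ ≤ (r / α * G) ^ (1 / r) := by
            gcongr
            calc ‖x (N + 1) - w‖ ^ r = r / α * (α / r * ‖x (N + 1) - w‖ ^ r) := by field_simp
              _ ≤ r / α * G := by gcongr
        _ = _ := Real.mul_rpow (by positivity) hG0
    have := mul_le_mul_of_nonneg_left hdistG hM0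
    have := hxopt w hw.1 hw.2
    linarith
  have hr0 : 0 < r := by linarith
  have hC0 : 0 ≤ M * (r / α) ^ (1 / r) := by positivity
  have hmax := rpow_le_max_of_mul_le_add_rpow (a := 12 * L_g * D ^ 2 * ℓ)
    (b := 8 * L_f * D ^ 2) hr hT1 (by positivity) (by positivity) hC0 hG0 (by linarith)
  rw [← mul_assoc 2] at hmax
  have := mul_le_mul_of_nonneg_left hmax hC0
  linarith
end

section
/- Suppose g satisfies the Hölderian error bound with r = 1 (weak sharpness). Run the AGM-BiO iteration with step sizes a_k = γ(k+1)/(4 L_f) where 0 < γ ≤ min{ 2 α L_f / (2 M L_g + α L_f), 1 } and M = max_{x ∈ X_g*} ‖∇f(x)‖. Then for every k ≥ 1, f(x_k) − f(x*) ≤ C_f / (γ k(k+1)), where C_f = 4 L_f ‖x_0 − x*‖². -/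
open RealInnerProductSpace

section

variable {F : Type*} [NormedAddCommGroup F] [InnerProductSpace ℝ F]

/-- Variational inequality characterizing the projection of `u` onto a convex set. -/
theorem Convex.inner_sub_sub_le_zero {K : Set F} (hK : Convex ℝ K) {u v : F} (hv : v ∈ K)
    (hmin : ∀ w ∈ K, ‖v - u‖ ≤ ‖w - u‖) {w : F} (hw : w ∈ K) : ⟪u - v, w - v⟫ ≤ 0 := by
  refine (norm_eq_iInf_iff_real_inner_le_zero hK hv).1 (le_antisymm ?_ ?_) w hw
  · have : Nonempty K := ⟨⟨v, hv⟩⟩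
    exact le_ciInf fun w => by simpa [norm_sub_rev] using hmin w w.2
  · exact ciInf_le (f := fun w : K => ‖u - w‖)
      ⟨0, Set.forall_mem_range.2 fun _ => norm_nonneg _⟩ ⟨v, hv⟩

variable [CompleteSpace F]

/-- First-order characterization of convexity: a convex function lies above its tangents. -/
theorem ConvexOn.inner_gradient_le_sub {f : F → ℝ} {f' u : F}
    (hf : ConvexOn ℝ Set.univ f) (hf' : HasGradientAt f f' u) (v : F) :
    ⟪f', v - u⟫ ≤ f v - f u := by
  have hline : ConvexOn ℝ Set.univ (f ∘ AffineMap.lineMap (k := ℝ) u v) := by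
    simpa using hf.comp_affineMap (AffineMap.lineMap (k := ℝ) u v)
  have hderiv : HasDerivAt (f ∘ AffineMap.lineMap (k := ℝ) u v) ⟪f', v - u⟫ 0 := by
    have h : HasFDerivAt f (InnerProductSpace.toDual ℝ F f')
        (AffineMap.lineMap (k := ℝ) u v (0 : ℝ)) := by
      simpa using hf'.hasFDerivAt
    simpa using h.comp_hasDerivAt (0 : ℝ) AffineMap.hasDerivAt_lineMap
  simpa [slope_def_field] using
    hline.le_slope_of_hasDerivAt (Set.mem_univ 0) (Set.mem_univ 1) one_pos hderiv

/-- A weak form of the descent lemma, with constant `L` in place of `L / 2`. -/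
theorem ConvexOn.sub_le_inner_gradient_add {f : F → ℝ} {f' : F → F} {L : ℝ}
    (hf : ConvexOn ℝ Set.univ f) (hf' : ∀ w, HasGradientAt f (f' w) w)
    (hL : ∀ u v, ‖f' u - f' v‖ ≤ L * ‖u - v‖) (u v : F) :
    f v - f u ≤ ⟪f' u, v - u⟫ + L * ‖v - u‖ ^ 2 := by
  have htangent := hf.inner_gradient_le_sub (hf' v) u
  have hinner : ⟪f' v - f' u, v - u⟫ ≤ L * ‖v - u‖ ^ 2 :=
    (real_inner_le_norm _ _).trans <| by
      nlinarith [mul_le_mul_of_nonneg_right (hL v u) (norm_nonneg (v - u))]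
  rw [inner_sub_left] at hinner
  rw [← neg_sub v u, inner_neg_right] at htangent
  linarith

/-- One step of the accelerated projected gradient method does not increase the potential
`A * (f x - f s) + ‖z - s‖ ^ 2 / 2`. -/
theorem accelerated_step_potential_le {f : F → ℝ} {f' : F → F} {L A a : ℝ} {K : Set F}
    (hf : ConvexOn ℝ Set.univ f) (hf' : ∀ w, HasGradientAt f (f' w) w)
    (hL : ∀ u v, ‖f' u - f' v‖ ≤ L * ‖u - v‖)
    (hA : 0 ≤ A) (ha : 0 < a) (hstep : 2 * L * a ^ 2 ≤ A + a)
    (hK : Convex ℝ K) {s x y z x₁ z₁ : F} (hs : s ∈ K)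
    (hy : y = (A / (A + a)) • x + (a / (A + a)) • z)
    (hx₁ : x₁ = (A / (A + a)) • x + (a / (A + a)) • z₁)
    (hz₁ : z₁ ∈ K) (hmin : ∀ w ∈ K, ‖z₁ - (z - a • f' y)‖ ≤ ‖w - (z - a • f' y)‖) :
    (A + a) * (f x₁ - f s) + ‖z₁ - s‖ ^ 2 / 2 ≤ A * (f x - f s) + ‖z - s‖ ^ 2 / 2 := by
  have hB : 0 < A + a := by positivity
  have hBy : (A + a) • y = A • x + a • z := by
    rw [hy, smul_add, smul_smul, smul_smul, mul_div_cancel₀ _ hB.ne', mul_div_cancel₀ _ hB.ne']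
  have hdiff : x₁ - y = (a / (A + a)) • (z₁ - z) := by
    rw [hx₁, hy, smul_sub]; abel
  have hproj := hK.inner_sub_sub_le_zero hz₁ hmin hs
  have htx := mul_le_mul_of_nonneg_left (hf.inner_gradient_le_sub (hf' y) x) hA
  have hts := mul_le_mul_of_nonneg_left (hf.inner_gradient_le_sub (hf' y) s) ha.le
  have hdesc : (A + a) * (f x₁ - f y) ≤ a * ⟪f' y, z₁ - z⟫ + ‖z₁ - z‖ ^ 2 / 2 := by
    have h := mul_le_mul_of_nonneg_left (hf.sub_le_inner_gradient_add hf' hL y x₁) hB.le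
    rw [hdiff, inner_smul_right, norm_smul, mul_pow, Real.norm_eq_abs, sq_abs] at h
    have hquad : L * a ^ 2 / (A + a) * ‖z₁ - z‖ ^ 2 ≤ 1 / 2 * ‖z₁ - z‖ ^ 2 := by
      refine mul_le_mul_of_nonneg_right ?_ (sq_nonneg _)
      rw [div_le_iff₀ hB]
      linarith
    calc (A + a) * (f x₁ - f y)
        ≤ _ := h
      _ = a * ⟪f' y, z₁ - z⟫ + L * a ^ 2 / (A + a) * ‖z₁ - z‖ ^ 2 := by field_simp
      _ ≤ _ := by linarith
  have hBy_inner : (A + a) * ⟪f' y, y⟫ = A * ⟪f' y, x⟫ + a * ⟪f' y, z⟫ := by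
    simpa [inner_add_right, inner_smul_right] using congrArg (fun w => ⟪f' y, w⟫) hBy
  have hzs : ‖z - s‖ ^ 2 = ‖z - z₁‖ ^ 2 - 2 * ⟪z - z₁, s - z₁⟫ + ‖z₁ - s‖ ^ 2 := by
    rw [← norm_sub_rev s z₁, ← norm_sub_sq_real, sub_sub_sub_cancel_right]
  rw [sub_right_comm, inner_sub_left, inner_smul_left, inner_sub_right (f' y)] at hproj
  simp only [conj_trivial] at hproj
  rw [norm_sub_rev z₁ z] at hdesc
  rw [inner_sub_right] at htx hts hdesc
  linarith

end

theorem agm_bio_weak_sharp_upper_bound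
    {n : ℕ} {f g : EuclideanSpace ℝ (Fin n) → ℝ}
    {f' g' : EuclideanSpace ℝ (Fin n) → EuclideanSpace ℝ (Fin n)}
    {Z : Set (EuclideanSpace ℝ (Fin n))}
    {L_f L_g : ℝ} (hLf : 0 < L_f) (hLg : 0 < L_g)
    (hZconv : Convex ℝ Z) (hZcl : IsClosed Z)
    (hfconv : ConvexOn ℝ Set.univ f) (hgconv : ConvexOn ℝ Set.univ g)
    (hf' : ∀ w, HasGradientAt f (f' w) w)
    (hg' : ∀ w, HasGradientAt g (g' w) w)
    (hLipf : ∀ u v, ‖f' u - f' v‖ ≤ L_f * ‖u - v‖)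
    (hLipg : ∀ u v, ‖g' u - g' v‖ ≤ L_g * ‖u - v‖)
    {xstar : EuclideanSpace ℝ (Fin n)}
    (hxZ : xstar ∈ Z)
    (hxlow : ∀ w ∈ Z, g xstar ≤ g w)
    (hxopt : ∀ w ∈ Z, (∀ u ∈ Z, g w ≤ g u) → f xstar ≤ f w)
    {α : ℝ} (hα : 0 < α)
    (hHEB : ∀ w ∈ Z, α * Metric.infDist w {w ∈ Z | ∀ u ∈ Z, g w ≤ g u} ≤ g w - g xstar)
    {M : ℝ} (hM : IsGreatest ((fun w => ‖f' w‖) '' {w ∈ Z | ∀ u ∈ Z, g w ≤ g u}) M)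
    {γ : ℝ} (hγ0 : 0 < γ)
    (hγ1 : γ ≤ min (2 * α * L_f / (2 * M * L_g + α * L_f)) 1)
    {x z y : ℕ → EuclideanSpace ℝ (Fin n)} {A a gs : ℕ → ℝ}
    (hA0 : A 0 = 0) (hxz0 : x 0 = z 0)
    (ha : ∀ k : ℕ, a k = γ * ((k : ℝ) + 1) / (4 * L_f))
    (hArec : ∀ k, A (k + 1) = A k + a k)
    (hy : ∀ k, y k = (A k / (A k + a k)) • x k + (a k / (A k + a k)) • z k)
    (hgs : ∀ k : ℕ, 0 ≤ gs k - g xstar ∧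
        gs k - g xstar ≤ 2 * L_g * ‖x 0 - xstar‖ ^ 2 / ((k : ℝ) + 1) ^ 2)
    (hzmem : ∀ k, z (k + 1) ∈ Z ∧ g (y k) + ⟪g' (y k), z (k + 1) - y k⟫ ≤ gs k)
    (hzproj : ∀ k, ∀ w ∈ Z, g (y k) + ⟪g' (y k), w - y k⟫ ≤ gs k →
        ‖z (k + 1) - (z k - a k • f' (y k))‖ ≤ ‖w - (z k - a k • f' (y k))‖)
    (hxrec : ∀ k, x (k + 1) = (A k / (A k + a k)) • x k + (a k / (A k + a k)) • z (k + 1)) :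
    ∀ k : ℕ, 1 ≤ k →
      f (x k) - f xstar ≤ 4 * L_f * ‖x 0 - xstar‖ ^ 2 / (γ * (k : ℝ) * ((k : ℝ) + 1)) := by
  have hapos (k : ℕ) : 0 < a k := by rw [ha]; positivity
  have hA (k : ℕ) : A k = γ * k * (k + 1) / (8 * L_f) := by
    induction k with
    | zero => simp [hA0]
    | succ k ih =>
      rw [hArec, ih, ha]
      push_cast
      field_simp
      ring
  have hγ : γ ≤ 1 := hγ1.trans (min_le_right _ _)
  have hstep (k : ℕ) : 2 * L_f * a k ^ 2 ≤ A k + a k := by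
    rw [hA, ha, ← sub_nonneg]
    have : γ * k * (k + 1) / (8 * L_f) + γ * (k + 1) / (4 * L_f)
        - 2 * L_f * (γ * (k + 1) / (4 * L_f)) ^ 2
        = γ * (k + 1) * (k * (1 - γ) + (1 - γ) + 1) / (8 * L_f) := by
      field_simp
      ring
    rw [this]
    have : 0 ≤ 1 - γ := sub_nonneg.2 hγ
    positivity
  have hpot (k : ℕ) :
      A k * (f (x k) - f xstar) + ‖z k - xstar‖ ^ 2 / 2 ≤ ‖x 0 - xstar‖ ^ 2 / 2 := by
    induction k with
    | zero => simp [hA0, hxz0]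
    | succ k ih =>
      have hAk : 0 ≤ A k := by rw [hA]; positivity
      have hK : Convex ℝ (Z ∩ {w | ⟪g' (y k), w⟫ ≤ gs k - g (y k) + ⟪g' (y k), y k⟫}) :=
        hZconv.inter (convex_halfSpace_le (innerₛₗ ℝ (g' (y k))).isLinear _)
      have hmem (w) : w ∈ Z ∩ {w | ⟪g' (y k), w⟫ ≤ gs k - g (y k) + ⟪g' (y k), y k⟫} ↔
          w ∈ Z ∧ g (y k) + ⟪g' (y k), w - y k⟫ ≤ gs k := by
        rw [Set.mem_inter_iff, Set.mem_ofPred_eq, inner_sub_right]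
        refine and_congr_right fun _ => ⟨fun h => ?_, fun h => ?_⟩ <;> linarith
      have hs := (hmem xstar).2
        ⟨hxZ, by linarith [hgconv.inner_gradient_le_sub (hg' (y k)) xstar, (hgs k).1]⟩
      rw [hArec]
      exact (accelerated_step_potential_le hfconv hf' hLipf hAk (hapos k) (hstep k) hK hs
        (hy k) (hxrec k) ((hmem _).2 (hzmem k))
        fun w hw => hzproj k w ((hmem w).1 hw).1 ((hmem w).1 hw).2).trans ih
  intro k hk
  have hk0 : (0 : ℝ) < k := by exact_mod_cast hk
  have h := hpot k
  rw [hA] at h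
  rw [le_div_iff₀ (by positivity)]
  have hscale : γ * k * (k + 1) / (8 * L_f) * (f (x k) - f xstar) ≤ ‖x 0 - xstar‖ ^ 2 / 2 := by
    linarith [sq_nonneg ‖z k - xstar‖]
  rw [div_mul_eq_mul_div, div_le_iff₀ (by positivity)] at hscale
  linarith
end

section
/- Let f be convex and differentiable and let g satisfy the r-th order Hölderian error bound on a closed convex set Z ⊆ ℝ^n. Define M = max_{x ∈ X_g*} ‖∇f(x)‖. Then for any x̂ ∈ Z, f(x̂) − f* ≥ −M ( r (g(x̂) − g*) / α )^{1/r}, where f* is the minimum of f over X_g*. -/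
open RealInnerProductSpace

/-- First-order lower bound for a convex function with a gradient. -/
theorem ConvexOn.add_inner_le_of_hasGradientAt_s10 {E : Type*} [NormedAddCommGroup E]
    [InnerProductSpace ℝ E] [CompleteSpace E] {f : E → ℝ} {v p : E}
    (hf : ConvexOn ℝ Set.univ f) (hv : HasGradientAt f v p) (x : E) :
    f p + ⟪v, x - p⟫ ≤ f x := by
  have hconv : ConvexOn ℝ Set.univ (f ∘ AffineMap.lineMap (k := ℝ) p x) :=
    hf.comp_affineMap (AffineMap.lineMap p x)
  have hderiv : HasDerivAt (f ∘ AffineMap.lineMap (k := ℝ) p x) ⟪v, x - p⟫ 0 := by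
    have hfp : HasFDerivAt f (InnerProductSpace.toDual ℝ E v)
        (AffineMap.lineMap (k := ℝ) p x 0) := by
      simpa using hv.hasFDerivAt
    simpa using hfp.comp_hasDerivAt (0 : ℝ) AffineMap.hasDerivAt_lineMap
  have h := hconv.le_slope_of_hasDerivAt (Set.mem_univ 0) (Set.mem_univ 1) one_pos hderiv
  simp only [slope_def_field, Function.comp_apply, AffineMap.lineMap_apply_zero,
    AffineMap.lineMap_apply_one, sub_zero, div_one] at h
  linarith

theorem heb_suboptimality_lower_bound
    {n : ℕ} {f g : EuclideanSpace ℝ (Fin n) → ℝ}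
    {f' g' : EuclideanSpace ℝ (Fin n) → EuclideanSpace ℝ (Fin n)}
    {Z : Set (EuclideanSpace ℝ (Fin n))}
    (hZconv : Convex ℝ Z) (hZcl : IsClosed Z)
    (hgconv : ConvexOn ℝ Set.univ g)
    (hg' : ∀ w, HasGradientAt g (g' w) w)
    (hfconv : ConvexOn ℝ Set.univ f)
    (hf' : ∀ w, HasGradientAt f (f' w) w)
    {gstar : ℝ} (hgstar : IsLeast (g '' Z) gstar)
    (hXgne : ({w ∈ Z | ∀ u ∈ Z, g w ≤ g u} : Set (EuclideanSpace ℝ (Fin n))).Nonempty)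
    (hXgcpt : IsCompact ({w ∈ Z | ∀ u ∈ Z, g w ≤ g u} : Set (EuclideanSpace ℝ (Fin n))))
    {α r : ℝ} (hα : 0 < α) (hr : 1 ≤ r)
    (hHEB : ∀ w ∈ Z, α / r * Metric.infDist w {w ∈ Z | ∀ u ∈ Z, g w ≤ g u} ^ r ≤ g w - gstar)
    {M : ℝ} (hM : IsGreatest ((fun w => ‖f' w‖) '' {w ∈ Z | ∀ u ∈ Z, g w ≤ g u}) M)
    {fstar : ℝ} (hfstar : IsLeast (f '' {w ∈ Z | ∀ u ∈ Z, g w ≤ g u}) fstar) :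
    ∀ xhat ∈ Z, f xhat - fstar ≥ -M * (r * (g xhat - gstar) / α) ^ (1 / r) := by
  intro xhat hxhat
  obtain ⟨p, hp, hdist⟩ := hXgcpt.exists_infDist_eq_dist hXgne xhat
  have hHEB_p := hHEB xhat hxhat
  rw [hdist, dist_eq_norm] at hHEB_p
  have hr0 : 0 < r := one_pos.trans_le hr
  have hnorm : ‖xhat - p‖ ≤ (r * (g xhat - gstar) / α) ^ (1 / r) := by
    have hpow : ‖xhat - p‖ ^ r ≤ r * (g xhat - gstar) / α := by
      rw [le_div_iff₀ hα]
      rw [div_mul_eq_mul_div, div_le_iff₀ hr0] at hHEB_p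
      linarith
    rw [one_div]
    exact (Real.le_rpow_inv_iff_of_pos (norm_nonneg _)
      ((Real.rpow_nonneg (norm_nonneg _) r).trans hpow) hr0).2 hpow
  have hM_p : ‖f' p‖ ≤ M := hM.2 ⟨p, hp, rfl⟩
  have hfstar_p : fstar ≤ f p := hfstar.2 ⟨p, hp, rfl⟩
  have hfirst := hfconv.add_inner_le_of_hasGradientAt_s10 (hf' p) xhat
  have hinner : -(‖f' p‖ * ‖xhat - p‖) ≤ ⟪f' p, xhat - p⟫ :=
    neg_le_of_abs_le (abs_real_inner_le_norm _ _)
  have hmul : ‖f' p‖ * ‖xhat - p‖ ≤ M * (r * (g xhat - gstar) / α) ^ (1 / r) :=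
    mul_le_mul hM_p hnorm (norm_nonneg _) ((norm_nonneg _).trans hM_p)
  linarith
end
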